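/- Let p ≥ 2, n = 3p, M = (1/3)·C(n−2,2), and let b, c be non-negative integers with b + c ≤ p−2. For i ∈ ℤ let ī denote the unique element of [n] with ī ≡ i (mod n). Let Σ = ⟨{ {ī, (i+p)¯, (i+2p)¯} : i=1,…,p }⟩, for i=1,…,n and j=1,…,p−1 let Δ(i,j) = ⟨{ī, (i+p)¯, (i+j+p)¯}, {(i+j+p)¯, (i+j+2p)¯, ī}⟩, let L = {Δ(i,j)} and M' = L ∖ {Δ(1,1),…,Δ(1,b)}, and let Γ = Σ ∪ (⋃_{Δ(i,j)∈M'} Δ(i,j)). For j = 1,…,p−2 let G_j = {1+p, 1+j+p, 1+j+2p}, and for k = 0,1,…,c let Δ_k = Γ ∪ ⟨G_{b+1}⟩ ∪ ⋯ ∪ ⟨G_{b+k}⟩. Then for every k = 0,1,…,c, the simplicial complex Δ_k is connected, Buchsbaum, and h(Δ_k) = (1, n−3, 3(M−b), −(M−b)+k). -/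

import Mathlib

open Finset

noncomputable section

/-- `Δ` is a simplicial complex on `[n] = {1,…,n}`: a collection of subsets of `[n]`,
closed under taking subsets, containing every singleton `{i}` for `i ∈ [n]`. -/
def IsComplexOn (n : ℕ) (Δ : Finset (Finset ℕ)) : Prop :=
  (∀ F ∈ Δ, ∀ G ⊆ F, G ∈ Δ) ∧
  (∀ F ∈ Δ, ∀ i ∈ F, i ∈ Finset.Icc 1 n) ∧
  (∀ i ∈ Finset.Icc 1 n, ({i} : Finset ℕ) ∈ Δ)

/-- a simplicial complex whose vertex set is contained in `[n]`:
a downward closed collection of subsets of `[n]`. -/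
def IsComplexIn (n : ℕ) (Δ : Finset (Finset ℕ)) : Prop :=
  (∀ F ∈ Δ, ∀ G ⊆ F, G ∈ Δ) ∧ (∀ F ∈ Δ, ∀ i ∈ F, i ∈ Finset.Icc 1 n)

/-- the faces of `Δ` with `m` vertices -/
def facesOf (Δ : Finset (Finset ℕ)) (m : ℕ) : Finset (Finset ℕ) :=
  Δ.filter fun F => F.card = m

/-- `fVec Δ j = f_{j-1}(Δ)`, the number of faces of `Δ` with `j` vertices;
by convention `f_{-1}(Δ) = 1`. -/
def fVec (Δ : Finset (Finset ℕ)) (j : ℕ) : ℤ :=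
  if j = 0 then 1 else ((facesOf Δ j).card : ℤ)

/-- the `h`-vector of a `(d-1)`-dimensional complex, defined by
`∑ f_{i-1} (x-1)^{d-i} = ∑ h_i x^{d-i}`, i.e.
`h_i = ∑_{j=0}^{i} (-1)^{i-j} C(d-j, i-j) f_{j-1}`. -/
def hVec (d : ℕ) (Δ : Finset (Finset ℕ)) (i : ℕ) : ℤ :=
  ∑ j ∈ Finset.range (i + 1),
    (-1 : ℤ) ^ (i - j) * ((d - j).choose (i - j) : ℤ) * fVec Δ j

/-- the dimension `max {k : f_k(Δ) ≠ 0}` of `Δ`, as an integer -/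
def dimZ (Δ : Finset (Finset ℕ)) : ℤ := ((Δ.sup Finset.card : ℕ) : ℤ) - 1

/-- the link `lk_Δ(F) = {G : G ∩ F = ∅, G ∪ F ∈ Δ}` -/
def link (Δ : Finset (Finset ℕ)) (F : Finset ℕ) : Finset (Finset ℕ) :=
  Δ.filter fun G => Disjoint G F ∧ G ∪ F ∈ Δ

variable (K : Type) [Field K]

/-- the simplicial boundary operator on formal `K`-linear combinations of
finite subsets of `ℕ` (vertices ordered by the order on `ℕ`):
`∂ F = ∑_{v ∈ F} (-1)^{#{u ∈ F : u < v}} (F \ {v})`. -/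
def bdry : (Finset ℕ →₀ K) →ₗ[K] (Finset ℕ →₀ K) :=
  Finsupp.lsum K fun F => LinearMap.toSpanSingleton K (Finset ℕ →₀ K)
    (∑ v ∈ F, ((-1 : K) ^ ((F.filter fun u => u < v).card)) • Finsupp.single (F.erase v) (1 : K))

/-- the space of simplicial `K`-chains of `Δ` spanned by the faces with `m` vertices
(for `m = 0` this is the span of the empty face, giving *reduced* homology) -/
def chains (Δ : Finset (Finset ℕ)) (m : ℕ) : Submodule K (Finset ℕ →₀ K) :=
  Submodule.span K ((fun F => Finsupp.single F (1 : K)) '' (facesOf Δ m : Set (Finset ℕ)))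

/-- the dimension of the reduced homology of `Δ` at faces of cardinality `m`:
`dim (ker ∂ ∩ C_m) - dim (∂ C_{m+1})` -/
def homDim (Δ : Finset (Finset ℕ)) (m : ℕ) : ℕ :=
  Module.finrank K ↥(chains K Δ m ⊓ LinearMap.ker (bdry K))
    - Module.finrank K ↥((chains K Δ (m + 1)).map (bdry K))

/-- the reduced Betti number `β_i(Δ; K) = dim_K H̃_i(Δ; K)` for `i : ℤ` -/
def betti (Δ : Finset (Finset ℕ)) (i : ℤ) : ℕ :=
  if 0 ≤ i + 1 then homDim K Δ (i + 1).toNat else 0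

/-- all facets (maximal faces) of `Δ` have the same cardinality -/
def IsPure (Δ : Finset (Finset ℕ)) : Prop :=
  ∀ F ∈ Δ, (∀ G ∈ Δ, F ⊆ G → F = G) → F.card = Δ.sup Finset.card

/-- `Δ` is Cohen–Macaulay (over `K`): for every face `F ∈ Δ` (including `∅`),
`β_i(lk_Δ(F)) = 0` for all `i ≠ dim Δ - |F|`. -/
def IsCohenMacaulay (Δ : Finset (Finset ℕ)) : Prop :=
  ∀ F ∈ Δ, ∀ i : ℤ, i ≠ dimZ Δ - F.card → betti K (link Δ F) i = 0

/-- `Δ` is Buchsbaum (over `K`): `Δ` is pure and the link of every vertex is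
Cohen–Macaulay. -/
def IsBuchsbaum (Δ : Finset (Finset ℕ)) : Prop :=
  IsPure Δ ∧ ∀ v : ℕ, ({v} : Finset ℕ) ∈ Δ → IsCohenMacaulay K (link Δ {v})

/-- `Δ` is connected: any two vertices are joined by a path of edges of `Δ` -/
def IsConnectedComplex (Δ : Finset (Finset ℕ)) : Prop :=
  ∀ u v : ℕ, ({u} : Finset ℕ) ∈ Δ → ({v} : Finset ℕ) ∈ Δ →
    Relation.ReflTransGen (fun a b : ℕ => a ≠ b ∧ ({a, b} : Finset ℕ) ∈ Δ) u v

/-- `Δ` is link-acyclic: `β_i(lk_Δ(v)) = 0` for every vertex `v` of `Δ` and every `i` -/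
def IsLinkAcyclic (Δ : Finset (Finset ℕ)) : Prop :=
  ∀ v : ℕ, ({v} : Finset ℕ) ∈ Δ → ∀ i : ℤ, betti K (link Δ {v}) i = 0

/-- `Δ` is `2`-dimensional with `h`-vector `(a, b, c, e)` -/
def hVector3 (Δ : Finset (Finset ℕ)) (a b c e : ℤ) : Prop :=
  hVec 3 Δ 0 = a ∧ hVec 3 Δ 1 = b ∧ hVec 3 Δ 2 = c ∧ hVec 3 Δ 3 = e

/-- `macaulay2 a = a^⟨2⟩`: if `a = C(b,2) + r` is the (greedy) `2`-nd Macaulay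
representation (`b` maximal with `C(b,2) ≤ a`, `0 ≤ r < b`, `r = C(r,1)`), then
`a^⟨2⟩ = C(b+1,3) + C(r+1,2)`, and `0^⟨2⟩ = 0`. -/
def macaulay2 (a : ℕ) : ℕ :=
  if a = 0 then 0
  else
    (Nat.findGreatest (fun t => t.choose 2 ≤ a) (a + 2) + 1).choose 3
      + (a - (Nat.findGreatest (fun t => t.choose 2 ≤ a) (a + 2)).choose 2 + 1).choose 2

/-- `modRep n i = ī`, the unique element of `[n] = {1,…,n}` congruent to `i` mod `n` -/
def modRep (n : ℕ) (i : ℤ) : ℕ := ((i - 1) % (n : ℤ)).toNat + 1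


/-- `Σ` for `n = 3p`: generated by `{ī, (i+p)¯, (i+2p)¯}`, `i = 1,…,p` -/
def SigmaB (p : ℕ) : Finset (Finset ℕ) :=
  (Finset.Icc 1 p).biUnion fun i =>
    ({modRep (3 * p) (i : ℤ), modRep (3 * p) ((i : ℤ) + p),
      modRep (3 * p) ((i : ℤ) + 2 * p)} : Finset ℕ).powerset

/-- `Δ(i,j)` for `n = 3p`: generated by `{ī, (i+p)¯, (i+j+p)¯}` and
`{(i+j+p)¯, (i+j+2p)¯, ī}` -/
def DeltaB (p i j : ℕ) : Finset (Finset ℕ) :=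
  ({modRep (3 * p) (i : ℤ), modRep (3 * p) ((i : ℤ) + p),
    modRep (3 * p) ((i : ℤ) + j + p)} : Finset ℕ).powerset ∪
  ({modRep (3 * p) ((i : ℤ) + j + p), modRep (3 * p) ((i : ℤ) + j + 2 * p),
    modRep (3 * p) (i : ℤ)} : Finset ℕ).powerset

open Classical in
/-- `Γ = Σ ∪ ⋃_{Δ(i,j) ∈ L ∖ {Δ(1,1),…,Δ(1,b)}} Δ(i,j)` for `n = 3p` -/
def GammaB (p b : ℕ) : Finset (Finset ℕ) :=
  SigmaB p ∪ ((((Finset.Icc 1 (3 * p)) ×ˢ (Finset.Icc 1 (p - 1))).filter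
    fun q : ℕ × ℕ => ∀ j' ∈ Finset.Icc 1 b, DeltaB p q.1 q.2 ≠ DeltaB p 1 j').biUnion
      fun q => DeltaB p q.1 q.2)

/-- `G_j = {1+p, 1+j+p, 1+j+2p}` -/
def GB (p j : ℕ) : Finset ℕ := {1 + p, 1 + j + p, 1 + j + 2 * p}

/-- `Δ_k = Γ ∪ ⟨G_{b+1}⟩ ∪ ⋯ ∪ ⟨G_{b+k}⟩` -/
def DeltaBk (p b k : ℕ) : Finset (Finset ℕ) :=
  GammaB p b ∪ (Finset.Icc (b + 1) (b + k)).biUnion fun j => (GB p j).powerset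

end

/-! ### Homology of connected graphs -/

section Homology

variable (K : Type) [Field K]

lemma bdry_single (F : Finset ℕ) :
    bdry K (Finsupp.single F 1) =
      ∑ v ∈ F, ((-1 : K) ^ (F.filter fun u => u < v).card) • Finsupp.single (F.erase v) (1 : K) := by
  simp [bdry]

lemma bdry_single_vertex (v : ℕ) :
    bdry K (Finsupp.single {v} 1) = Finsupp.single ∅ (1 : K) := by
  simp [bdry_single, Finset.filter_singleton]

lemma bdry_single_edge {u v : ℕ} (h : u < v) :
    bdry K (Finsupp.single {u, v} 1) = Finsupp.single {v} (1 : K) - Finsupp.single {u} 1 := by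
  have e1 : ({u, v} : Finset ℕ).filter (fun x => x < u) = ∅ := by ext; simp; omega
  have e2 : ({u, v} : Finset ℕ).filter (fun x => x < v) = {u} := by ext; simp; omega
  have e3 : ({u, v} : Finset ℕ).erase u = {v} := by ext; simp; omega
  have e4 : ({u, v} : Finset ℕ).erase v = {u} := by ext; simp; omega
  rw [bdry_single, Finset.sum_pair h.ne, e1, e2, e3, e4]
  simp [sub_eq_add_neg]

lemma single_mem_chains {Δ : Finset (Finset ℕ)} {F : Finset ℕ} {m : ℕ} (hF : F ∈ Δ)
    (hm : F.card = m) : Finsupp.single F (1 : K) ∈ chains K Δ m :=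
  Submodule.subset_span ⟨F, by simp [facesOf, hF, hm], rfl⟩

instance finiteDimensional_chains (Δ : Finset (Finset ℕ)) (m : ℕ) :
    FiniteDimensional K (chains K Δ m) :=
  FiniteDimensional.span_of_finite K ((facesOf Δ m).finite_toSet.image _)

lemma homDim_eq_zero_of_le {Δ : Finset (Finset ℕ)} {m : ℕ}
    (h : chains K Δ m ⊓ LinearMap.ker (bdry K) ≤ (chains K Δ (m + 1)).map (bdry K)) :
    homDim K Δ m = 0 :=
  Nat.sub_eq_zero_of_le (Submodule.finrank_mono h)

lemma homDim_eq_zero_of_card_lt {Δ : Finset (Finset ℕ)} {m : ℕ} (h : ∀ F ∈ Δ, F.card < m) :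
    homDim K Δ m = 0 := by
  have : facesOf Δ m = ∅ := Finset.filter_eq_empty_iff.2 fun F hF => (h F hF).ne
  exact homDim_eq_zero_of_le K (by simp [chains, this])

lemma homDim_zero_eq_zero {Δ : Finset (Finset ℕ)} {v : ℕ} (hv : {v} ∈ Δ) :
    homDim K Δ 0 = 0 := by
  refine homDim_eq_zero_of_le K (inf_le_left.trans (Submodule.span_le.2 ?_))
  rintro _ ⟨F, hF, rfl⟩
  obtain rfl : F = ∅ := by simpa using (Finset.mem_filter.1 hF).2
  exact ⟨_, single_mem_chains K hv (by simp), bdry_single_vertex K v⟩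

/-- The edge relation of a complex. -/
abbrev EdgeRel (Δ : Finset (Finset ℕ)) (a b : ℕ) : Prop := a ≠ b ∧ ({a, b} : Finset ℕ) ∈ Δ

lemma single_sub_single_mem_of_edge {Δ : Finset (Finset ℕ)} {u v : ℕ} (h : EdgeRel Δ u v) :
    Finsupp.single {u} (1 : K) - Finsupp.single {v} 1 ∈ (chains K Δ 2).map (bdry K) := by
  obtain ⟨hne, h⟩ := h
  rcases lt_or_gt_of_ne hne with hlt | hlt
  · rw [← neg_sub, ← bdry_single_edge K hlt]
    exact neg_mem (Submodule.mem_map_of_mem (single_mem_chains K h (Finset.card_pair hne)))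
  · rw [← bdry_single_edge K hlt]
    rw [Finset.pair_comm] at h
    exact Submodule.mem_map_of_mem (single_mem_chains K h (Finset.card_pair hne.symm))

lemma single_sub_single_mem {Δ : Finset (Finset ℕ)} {u v : ℕ}
    (h : Relation.ReflTransGen (EdgeRel Δ) u v) :
    Finsupp.single {u} (1 : K) - Finsupp.single {v} 1 ∈ (chains K Δ 2).map (bdry K) := by
  induction h with
  | refl => simp
  | tail _ h ih => simpa using add_mem ih (single_sub_single_mem_of_edge K h)

lemma homDim_one_eq_zero {Δ : Finset (Finset ℕ)} {r : ℕ}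
    (h : ∀ u, {u} ∈ Δ → Relation.ReflTransGen (EdgeRel Δ) u r) : homDim K Δ 1 = 0 := by
  apply homDim_eq_zero_of_le
  have key : ∀ x ∈ chains K Δ 1, ∃ a : K, bdry K x = a • Finsupp.single ∅ 1 ∧
      x - a • Finsupp.single {r} 1 ∈ (chains K Δ 2).map (bdry K) := by
    intro x hx
    induction hx using Submodule.span_induction with
    | mem x hx =>
      obtain ⟨F, hF, rfl⟩ := hx
      obtain ⟨hF, hc⟩ := Finset.mem_filter.1 hF
      obtain ⟨u, rfl⟩ := Finset.card_eq_one.1 hc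
      exact ⟨1, by simp [bdry_single_vertex], by simpa using single_sub_single_mem K (h u hF)⟩
    | zero => exact ⟨0, by simp, by simp⟩
    | add x y _ _ hx hy =>
      obtain ⟨a, ha, ha'⟩ := hx
      obtain ⟨b, hb, hb'⟩ := hy
      refine ⟨a + b, by rw [map_add, ha, hb, add_smul], ?_⟩
      have := add_mem ha' hb'
      rwa [sub_add_sub_comm, ← add_smul] at this
    | smul t x _ hx =>
      obtain ⟨a, ha, ha'⟩ := hx
      refine ⟨t * a, by rw [map_smul, ha, mul_smul], ?_⟩
      have := Submodule.smul_mem _ t ha'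
      rwa [smul_sub, ← mul_smul] at this
  rintro x ⟨hx, hx'⟩
  obtain ⟨a, ha, ha'⟩ := key x hx
  rw [LinearMap.mem_ker.1 hx'] at ha
  have : a = 0 := by simpa [eq_comm] using ha
  simpa [this] using ha'

/-- A connected graph without isolated vertices, with at least one edge, is Cohen–Macaulay. -/
lemma isCohenMacaulay_of_connected {Δ : Finset (Finset ℕ)} {r s : ℕ}
    (hdown : ∀ F ∈ Δ, ∀ G ⊆ F, G ∈ Δ) (hcard : ∀ F ∈ Δ, F.card ≤ 2) (hrs : EdgeRel Δ r s)
    (h : ∀ u, {u} ∈ Δ → Relation.ReflTransGen (EdgeRel Δ) u r) : IsCohenMacaulay K Δ := by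
  have hdim : Δ.sup Finset.card = 2 :=
    le_antisymm (Finset.sup_le hcard)
      ((Finset.card_pair hrs.1).symm.le.trans (Finset.le_sup (f := Finset.card) hrs.2))
  intro F hF i hi
  have hFc := hcard F hF
  rw [dimZ, hdim] at hi
  unfold betti
  split_ifs with h0
  swap
  · rfl
  obtain ⟨m, hm⟩ := Int.eq_ofNat_of_zero_le h0
  rw [hm, Int.toNat_natCast]
  have hmF : m + F.card ≠ 2 := by push_cast at hi; omega
  have hlink : ∀ G ∈ link Δ F, G.card + F.card ≤ 2 := by
    intro G hG
    obtain ⟨-, hd, hG⟩ := Finset.mem_filter.1 hG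
    rw [← Finset.card_union_of_disjoint hd]
    exact hcard _ hG
  rcases lt_or_gt_of_ne hmF with hlt | hgt
  swap
  · exact homDim_eq_zero_of_card_lt K fun G hG => by have := hlink G hG; omega
  have hempty : link Δ ∅ = Δ := by ext; simp [link]
  have hex : ∀ u, {u} ∈ Δ → ∃ w, EdgeRel Δ u w := by
    intro u hu
    rcases (h u hu).cases_head with rfl | ⟨w, hw, -⟩
    exacts [⟨s, hrs⟩, ⟨w, hw⟩]
  obtain rfl | hm0 := m.eq_zero_or_pos
  · obtain hF0 | hF1 : F.card = 0 ∨ F.card = 1 := by omega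
    · obtain rfl := Finset.card_eq_zero.1 hF0
      rw [hempty]
      exact homDim_zero_eq_zero K (hdown _ hrs.2 {r} (by simp))
    · obtain ⟨u, rfl⟩ := Finset.card_eq_one.1 hF1
      obtain ⟨w, hne, hw⟩ := hex u hF
      refine homDim_zero_eq_zero K (v := w) (Finset.mem_filter.2 ⟨hdown _ hw _ (by simp), ?_, ?_⟩)
      · simpa using hne.symm
      · rwa [Finset.pair_comm] at hw
  · obtain rfl : m = 1 := by omega
    obtain rfl := Finset.card_eq_zero.1 (by omega : F.card = 0)
    rw [hempty]
    exact homDim_one_eq_zero K h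

end Homology

/-! ### Faces of `Δ_k` -/

/-- The element of `{1, …, 3p}` congruent to `a` modulo `3p`, for `1 ≤ a ≤ 6p`. -/
def wrap (p a : ℕ) : ℕ := if a ≤ 3 * p then a else a - 3 * p

/-- The triangle `{ī, (i+p)¯, (i+j+p)¯}`. -/
def tri (p i j : ℕ) : Finset ℕ := {i, wrap p (i + p), wrap p (i + j + p)}

/-- The triangle `tri p i j` does not belong to any of the removed `Δ(1,1), …, Δ(1,b)`. -/
def IsKept (p b i j : ℕ) : Prop :=
  ¬(i = 1 ∧ j ≤ b) ∧ ¬(p + 2 ≤ i ∧ i ≤ p + 1 + b ∧ i + j = 2 * p + 1)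

instance (p b i j : ℕ) : Decidable (IsKept p b i j) := by unfold IsKept; infer_instance

lemma mem_tri {p i j x : ℕ} :
    x ∈ tri p i j ↔ x = i ∨ x = wrap p (i + p) ∨ x = wrap p (i + j + p) := by
  simp [tri]

lemma modRep_eq_wrap {p a : ℕ} (h1 : 1 ≤ a) (h2 : a ≤ 6 * p) :
    modRep (3 * p) (a : ℤ) = wrap p a := by
  unfold modRep wrap
  split_ifs with h
  · rw [Int.emod_eq_of_lt (by omega) (by push_cast; omega)]
    omega
  · rw [← Int.sub_emod_right, Int.emod_eq_of_lt (by push_cast; omega) (by push_cast; omega)]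
    push_cast
    omega

lemma wrap_of_le {p a : ℕ} (h : a ≤ 3 * p) : wrap p a = a := if_pos h

lemma card_tri {p i j : ℕ} (hi : 1 ≤ i) (hi' : i ≤ 3 * p) (hj : 1 ≤ j) (hj' : j ≤ p) :
    (tri p i j).card = 3 := by
  rw [tri, Finset.card_eq_three]
  refine ⟨_, _, _, ?_, ?_, ?_, rfl⟩ <;> unfold wrap <;> split_ifs <;> omega

lemma eq_of_mem_tri {p i j x : ℕ} (hi : 1 ≤ i) (hi' : i ≤ 3 * p) (hj : 1 ≤ j) (hj' : j < p)
    (h : x ∈ tri p i j) (h' : wrap p (x + p) ∈ tri p i j) : x = i := by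
  rw [mem_tri] at h h'
  unfold wrap at h h'
  split_ifs at h h' <;> omega

lemma tri_subset_tri {p i j i' j' : ℕ} (hj : 1 ≤ j)
    (h2i : 1 ≤ i') (h2i' : i' ≤ 3 * p) (h2j : 1 ≤ j') (h2j' : j' < p) (hj' : j < p)
    (h : tri p i j ⊆ tri p i' j') : i = i' ∧ j = j' := by
  obtain rfl : i = i' := eq_of_mem_tri h2i h2i' h2j h2j' (h (mem_tri.2 (Or.inl rfl)))
    (h (mem_tri.2 (Or.inr (Or.inl rfl))))
  have := h (mem_tri.2 (Or.inr (Or.inr rfl)))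
  rw [mem_tri] at this
  unfold wrap at this
  split_ifs at this <;> omega

lemma DeltaB_eq {p i j : ℕ} (hi : 1 ≤ i) (hi' : i ≤ 3 * p) (hj : 1 ≤ j) (hj' : j < p) :
    DeltaB p i j =
      (tri p i j).powerset ∪ (tri p (wrap p (i + j + p)) (p - j)).powerset := by
  have e1 : modRep (3 * p) (i : ℤ) = i := by
    rw [modRep_eq_wrap hi (by omega), wrap_of_le hi']
  have e2 : modRep (3 * p) ((i : ℤ) + p) = wrap p (i + p) := by
    rw [← modRep_eq_wrap (by omega) (by omega)]; push_cast; rfl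
  have e3 : modRep (3 * p) ((i : ℤ) + j + p) = wrap p (i + j + p) := by
    rw [← modRep_eq_wrap (by omega) (by omega)]; push_cast; rfl
  have e4 : modRep (3 * p) ((i : ℤ) + j + 2 * p) = wrap p (wrap p (i + j + p) + p) := by
    have : wrap p (wrap p (i + j + p) + p) = wrap p (i + j + 2 * p) := by
      unfold wrap; split_ifs <;> omega
    rw [this, ← modRep_eq_wrap (by omega) (by omega)]; push_cast; rfl
  have e5 : i = wrap p (wrap p (i + j + p) + (p - j) + p) := by
    unfold wrap; split_ifs <;> omega
  rw [DeltaB, e1, e2, e3, e4, tri, tri, ← e5]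

lemma DeltaB_eq_DeltaB {p i j : ℕ} (hi : 1 ≤ i) (hi' : i ≤ 3 * p) (hj : 1 ≤ j) (hj' : j < p) :
    DeltaB p (wrap p (i + j + p)) (p - j) = DeltaB p i j := by
  have h1 : 1 ≤ wrap p (i + j + p) := by unfold wrap; split_ifs <;> omega
  have h2 : wrap p (i + j + p) ≤ 3 * p := by unfold wrap; split_ifs <;> omega
  rw [DeltaB_eq h1 h2 (by omega) (by omega), DeltaB_eq hi hi' hj hj', Finset.union_comm]
  have e1 : wrap p (wrap p (i + j + p) + (p - j) + p) = i := by
    unfold wrap; split_ifs <;> omega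
  rw [e1, Nat.sub_sub_self hj'.le]

lemma IsKept.pair {p b i j : ℕ} (h : IsKept p b i j) (hi : 1 ≤ i) (hi' : i ≤ 3 * p)
    (hj : 1 ≤ j) (hj' : j < p) : IsKept p b (wrap p (i + j + p)) (p - j) := by
  unfold IsKept wrap at *
  split_ifs <;> omega

lemma DeltaB_ne_iff_isKept {p b i j : ℕ} (hb : b < p) (hi : 1 ≤ i) (hi' : i ≤ 3 * p)
    (hj : 1 ≤ j) (hj' : j < p) :
    (∀ j' ∈ Finset.Icc 1 b, DeltaB p i j ≠ DeltaB p 1 j') ↔ IsKept p b i j := by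
  constructor
  · intro h
    refine ⟨?_, ?_⟩
    · rintro ⟨rfl, hjb⟩
      exact h j (Finset.mem_Icc.2 ⟨hj, hjb⟩) rfl
    · rintro ⟨h1, h2, h3⟩
      refine h (i - p - 1) (Finset.mem_Icc.2 ⟨by omega, by omega⟩) ?_
      rw [← DeltaB_eq_DeltaB (i := 1) le_rfl (by omega) (by omega) (by omega),
        wrap_of_le (by omega)]
      congr 1 <;> omega
  · intro h j' hj2 heq
    rw [Finset.mem_Icc] at hj2
    have hmem : tri p i j ∈ DeltaB p 1 j' := by
      rw [← heq, DeltaB_eq hi hi' hj hj']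
      simp
    rw [DeltaB_eq le_rfl (by omega) hj2.1 (by omega), wrap_of_le (by omega), Finset.mem_union,
      Finset.mem_powerset, Finset.mem_powerset] at hmem
    unfold IsKept at h
    rcases hmem with hmem | hmem
    · have := tri_subset_tri hj le_rfl (by omega) hj2.1 (by omega) hj' hmem
      omega
    · have := tri_subset_tri hj (by omega) (by omega) (by omega) (by omega) hj' hmem
      omega

lemma mem_SigmaB {p : ℕ} {F : Finset ℕ} :
    F ∈ SigmaB p ↔ ∃ i, 1 ≤ i ∧ i ≤ p ∧ F ⊆ tri p i p := by
  have key : ∀ i, 1 ≤ i → i ≤ p →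
      ({modRep (3 * p) (i : ℤ), modRep (3 * p) ((i : ℤ) + p),
        modRep (3 * p) ((i : ℤ) + 2 * p)} : Finset ℕ) = tri p i p := by
    intro i h1 h2
    have e1 : modRep (3 * p) (i : ℤ) = i := by
      rw [modRep_eq_wrap h1 (by omega), wrap_of_le (by omega)]
    have e2 : modRep (3 * p) ((i : ℤ) + p) = wrap p (i + p) := by
      rw [← modRep_eq_wrap (by omega) (by omega)]; push_cast; rfl
    have e3 : modRep (3 * p) ((i : ℤ) + 2 * p) = wrap p (i + p + p) := by
      rw [← modRep_eq_wrap (by omega) (by omega)]; push_cast; congr 1; ring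
    rw [e1, e2, e3, tri]
  simp only [SigmaB, Finset.mem_biUnion, Finset.mem_Icc, Finset.mem_powerset]
  constructor
  · rintro ⟨i, ⟨h1, h2⟩, h⟩
    exact ⟨i, h1, h2, key i h1 h2 ▸ h⟩
  · rintro ⟨i, h1, h2, h⟩
    exact ⟨i, ⟨h1, h2⟩, (key i h1 h2).symm ▸ h⟩

lemma tri_self_mem_SigmaB {p i : ℕ} (hi : 1 ≤ i) (hi' : i ≤ 3 * p) : tri p i p ∈ SigmaB p := by
  rw [mem_SigmaB]
  obtain h | h | h : i ≤ p ∨ (p < i ∧ i ≤ 2 * p) ∨ 2 * p < i := by omega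
  · exact ⟨i, hi, h, subset_rfl⟩
  · refine ⟨i - p, by omega, by omega, fun x => ?_⟩
    simp only [mem_tri]
    unfold wrap
    split_ifs <;> omega
  · refine ⟨i - 2 * p, by omega, by omega, fun x => ?_⟩
    simp only [mem_tri]
    unfold wrap
    split_ifs <;> omega

lemma mem_GammaB {p b : ℕ} (hb : b < p) {F : Finset ℕ} :
    F ∈ GammaB p b ↔
      ∃ i j, 1 ≤ i ∧ i ≤ 3 * p ∧ 1 ≤ j ∧ j ≤ p ∧ IsKept p b i j ∧ F ⊆ tri p i j := by
  simp only [GammaB, Finset.mem_union, mem_SigmaB, Finset.mem_biUnion, Finset.mem_filter,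
    Finset.mem_product]
  constructor
  · rintro (⟨i, h1, h2, h⟩ | ⟨⟨i, j⟩, ⟨⟨hi, hj⟩, hk⟩, h⟩)
    · exact ⟨i, p, h1, by omega, by omega, le_rfl, by unfold IsKept; omega, h⟩
    · simp only [Finset.mem_Icc] at hi hj
      rw [DeltaB_ne_iff_isKept hb hi.1 hi.2 hj.1 (by omega)] at hk
      rw [DeltaB_eq hi.1 hi.2 hj.1 (by omega), Finset.mem_union, Finset.mem_powerset,
        Finset.mem_powerset] at h
      rcases h with h | h
      · exact ⟨i, j, hi.1, hi.2, hj.1, by omega, hk, h⟩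
      · refine ⟨_, _, ?_, ?_, ?_, ?_, hk.pair hi.1 hi.2 hj.1 (by omega), h⟩
        all_goals first | omega | (unfold wrap; split_ifs <;> omega)
  · rintro ⟨i, j, hi, hi', hj, hj', hk, h⟩
    obtain rfl | hjp := hj'.eq_or_lt
    · left
      obtain ⟨i', h1, h2, h'⟩ := mem_SigmaB.1 (tri_self_mem_SigmaB hi hi')
      exact ⟨i', h1, h2, h.trans h'⟩
    · right
      refine ⟨(i, j), ⟨⟨Finset.mem_Icc.2 ⟨hi, hi'⟩, Finset.mem_Icc.2 ⟨hj, by omega⟩⟩,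
        (DeltaB_ne_iff_isKept hb hi hi' hj hjp).2 hk⟩, ?_⟩
      rw [DeltaB_eq hi hi' hj hjp]
      exact Finset.mem_union_left _ (Finset.mem_powerset.2 h)

lemma mem_DeltaBk {p b k : ℕ} (hb : b < p) {F : Finset ℕ} :
    F ∈ DeltaBk p b k ↔
      (∃ i j, 1 ≤ i ∧ i ≤ 3 * p ∧ 1 ≤ j ∧ j ≤ p ∧ IsKept p b i j ∧ F ⊆ tri p i j) ∨
      ∃ j, b + 1 ≤ j ∧ j ≤ b + k ∧ F ⊆ GB p j := by
  simp [DeltaBk, mem_GammaB hb, and_assoc]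

lemma mem_GB {p j x : ℕ} : x ∈ GB p j ↔ x = 1 + p ∨ x = 1 + j + p ∨ x = 1 + j + 2 * p := by
  simp [GB]

lemma card_GB {p j : ℕ} (hp : 1 ≤ p) (hj : 1 ≤ j) : (GB p j).card = 3 := by
  rw [GB, Finset.card_eq_three]
  refine ⟨_, _, _, ?_, ?_, ?_, rfl⟩ <;> omega

lemma mem_DeltaBk_of_subset {p b k : ℕ} {F G : Finset ℕ} (hb : b < p) (hF : F ∈ DeltaBk p b k)
    (h : G ⊆ F) : G ∈ DeltaBk p b k := by
  rw [mem_DeltaBk hb] at *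
  rcases hF with ⟨i, j, h1, h2, h3, h4, h5, hF⟩ | ⟨j, h1, h2, hF⟩
  exacts [Or.inl ⟨i, j, h1, h2, h3, h4, h5, h.trans hF⟩, Or.inr ⟨j, h1, h2, h.trans hF⟩]

/-- Every face of `Δ_k` lies in a face with three vertices. -/
lemma exists_superset_card_three {p b k : ℕ} (hb : b < p) {F : Finset ℕ}
    (hF : F ∈ DeltaBk p b k) : ∃ G ∈ DeltaBk p b k, F ⊆ G ∧ G.card = 3 := by
  have hF' := hF
  rw [mem_DeltaBk hb] at hF'
  rcases hF' with ⟨i, j, h1, h2, h3, h4, h5, hF'⟩ | ⟨j, h1, h2, hF'⟩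
  · exact ⟨tri p i j, (mem_DeltaBk hb).2 (Or.inl ⟨i, j, h1, h2, h3, h4, h5, subset_rfl⟩), hF',
      card_tri h1 h2 h3 h4⟩
  · exact ⟨GB p j, (mem_DeltaBk hb).2 (Or.inr ⟨j, h1, h2, subset_rfl⟩), hF',
      card_GB (by omega) (by omega)⟩

lemma card_le_three {p b k : ℕ} (hb : b < p) {F : Finset ℕ} (hF : F ∈ DeltaBk p b k) :
    F.card ≤ 3 := by
  obtain ⟨G, -, hFG, hG⟩ := exists_superset_card_three hb hF
  exact hG ▸ Finset.card_le_card hFG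

lemma mem_Icc_of_mem_face {p b k : ℕ} (hb : b + k < p) {F : Finset ℕ}
    (hF : F ∈ DeltaBk p b k) {x : ℕ} (hx : x ∈ F) : x ∈ Finset.Icc 1 (3 * p) := by
  rw [mem_DeltaBk (by omega)] at hF
  rw [Finset.mem_Icc]
  rcases hF with ⟨i, j, h1, h2, h3, h4, h5, hF⟩ | ⟨j, h1, h2, hF⟩
  · have := mem_tri.1 (hF hx)
    unfold wrap at this
    split_ifs at this <;> omega
  · have := mem_GB.1 (hF hx)
    omega

lemma tri_face {p b k i j : ℕ} {F : Finset ℕ} (hb : b < p) (hi : 1 ≤ i) (hi' : i ≤ 3 * p)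
    (hj : 1 ≤ j) (hj' : j ≤ p) (hk : IsKept p b i j) (hF : F ⊆ tri p i j) :
    F ∈ DeltaBk p b k :=
  (mem_DeltaBk hb).2 (Or.inl ⟨i, j, hi, hi', hj, hj', hk, hF⟩)

lemma singleton_mem_DeltaBk {p b k : ℕ} (hb : b + k < p) {v : ℕ} :
    {v} ∈ DeltaBk p b k ↔ v ∈ Finset.Icc 1 (3 * p) := by
  refine ⟨fun h => mem_Icc_of_mem_face hb h (Finset.mem_singleton_self v), fun h => ?_⟩
  rw [Finset.mem_Icc] at h
  exact tri_face (i := v) (j := p) (by omega) h.1 h.2 (by omega) le_rfl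
    (by unfold IsKept; omega) (by simp [tri])

/-- The pairs `{u, v}`, `u < v`, which are edges of none of the kept triangles. -/
def IsRemovedEdge (p b u v : ℕ) : Prop :=
  (u = 1 + p ∧ p + 2 ≤ v ∧ v ≤ p + 1 + b) ∨
    (u = 1 ∧ (p + 2 ≤ v ∧ v ≤ p + 1 + b ∨ 2 * p + 2 ≤ v ∧ v ≤ 2 * p + 1 + b))

lemma pair_subset_iff {u v : ℕ} {F : Finset ℕ} : {u, v} ⊆ F ↔ u ∈ F ∧ v ∈ F := by
  simp [Finset.insert_subset_iff]

lemma triple_subset_iff {u v w : ℕ} {F : Finset ℕ} :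
    {u, v, w} ⊆ F ↔ u ∈ F ∧ v ∈ F ∧ w ∈ F := by
  simp [Finset.insert_subset_iff]

lemma pair_mem_DeltaBk {p b k : ℕ} (hb : b + k < p) {u v : ℕ} (huv : u < v) :
    {u, v} ∈ DeltaBk p b k ↔ 1 ≤ u ∧ v ≤ 3 * p ∧ ¬IsRemovedEdge p b u v := by
  constructor
  · intro h
    have hu := Finset.mem_Icc.1 (mem_Icc_of_mem_face hb h (x := u) (by simp))
    have hv := Finset.mem_Icc.1 (mem_Icc_of_mem_face hb h (x := v) (by simp))
    refine ⟨hu.1, hv.2, ?_⟩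
    rw [mem_DeltaBk (by omega)] at h
    unfold IsRemovedEdge
    rcases h with ⟨i, j, h1, h2, h3, h4, h5, hF⟩ | ⟨j, h1, h2, hF⟩
    · rw [pair_subset_iff, mem_tri, mem_tri] at hF
      unfold IsKept at h5
      unfold wrap at hF
      obtain ⟨hF1, hF2⟩ := hF
      rcases hF1 with hF1 | hF1 | hF1 <;> rcases hF2 with hF2 | hF2 | hF2 <;>
        (try split_ifs at hF1 hF2) <;> omega
    · rw [pair_subset_iff, mem_GB, mem_GB] at hF
      omega
  · rintro ⟨hu, hv, h⟩
    have hb' : b < p := by omega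
    unfold IsRemovedEdge at h
    have key : ∃ i j, 1 ≤ i ∧ i ≤ 3 * p ∧ 1 ≤ j ∧ j ≤ p ∧ IsKept p b i j ∧
        {u, v} ⊆ tri p i j := by
      simp only [pair_subset_iff, mem_tri]
      unfold IsKept
      obtain hd | hd | hd | hd | hd : v < u + p ∨ v = u + p ∨ (u + p < v ∧ v < u + 2 * p) ∨
        v = u + 2 * p ∨ u + 2 * p < v := by omega
      · refine ⟨wrap p (u + 2 * p), v - u, ?_⟩
        unfold wrap
        split_ifs <;> omega
      · refine ⟨u, p, ?_⟩
        unfold wrap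
        split_ifs <;> omega
      · refine ⟨u, v - u - p, ?_⟩
        unfold wrap
        split_ifs <;> omega
      · refine ⟨v, p, ?_⟩
        unfold wrap
        split_ifs <;> omega
      · refine ⟨v - p, 3 * p + u - v, ?_⟩
        unfold wrap
        split_ifs <;> omega
    obtain ⟨i, j, h1, h2, h3, h4, h5, hF⟩ := key
    exact tri_face hb' h1 h2 h3 h4 h5 hF

lemma isConnectedComplex_DeltaBk {p b k : ℕ} (hb : b + k + 1 < p) :
    IsConnectedComplex (DeltaBk p b k) := by
  have key : ∀ u, u ∈ Finset.Icc 1 (3 * p) → u ≠ 3 * p →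
      ({u, 3 * p} : Finset ℕ) ∈ DeltaBk p b k := by
    intro u hu hne
    rw [Finset.mem_Icc] at hu
    rw [pair_mem_DeltaBk (by omega) (by omega)]
    unfold IsRemovedEdge
    omega
  intro u v hu hv
  rw [singleton_mem_DeltaBk (by omega)] at hu hv
  refine Relation.ReflTransGen.trans (b := 3 * p) ?_ ?_
  · by_cases h : u = 3 * p
    · rw [h]
    · exact .single ⟨h, key u hu h⟩
  · by_cases h : v = 3 * p
    · rw [h]
    · exact .single ⟨Ne.symm h, by rw [Finset.pair_comm]; exact key v hv h⟩

lemma isPure_DeltaBk {p b k : ℕ} (hb : b < p) : IsPure (DeltaBk p b k) := by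
  intro F hF hmax
  obtain ⟨G, hG, hFG, hGc⟩ := exists_superset_card_three hb hF
  obtain rfl := hmax G hG hFG
  rw [hGc]
  exact le_antisymm (hGc ▸ Finset.le_sup (f := Finset.card) hF)
    (Finset.sup_le fun H hH => card_le_three hb hH)

lemma edgeRel_link_iff {Δ : Finset (Finset ℕ)} (hdown : ∀ F ∈ Δ, ∀ G ⊆ F, G ∈ Δ) {v x y : ℕ} :
    EdgeRel (link Δ {v}) x y ↔ x ≠ y ∧ x ≠ v ∧ y ≠ v ∧ {x, y, v} ∈ Δ := by
  have h : ({x, y} : Finset ℕ) ∪ {v} = {x, y, v} := by ext; simp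
  simp only [EdgeRel, link, Finset.mem_filter, h, Finset.disjoint_singleton_right,
    Finset.mem_insert, Finset.mem_singleton]
  constructor
  · rintro ⟨h1, -, h2, h3⟩
    exact ⟨h1, by omega, by omega, h3⟩
  · rintro ⟨h1, h2, h3, h4⟩
    exact ⟨h1, hdown _ h4 _ (fun z => by simp; tauto), by omega, h4⟩

lemma edgeRel_link_of_tri {p b k v x y i j : ℕ} (hb : b < p) (hxy : x ≠ y) (hx : x ≠ v)
    (hy : y ≠ v) (hi : 1 ≤ i ∧ i ≤ 3 * p) (hj : 1 ≤ j ∧ j ≤ p) (hk : IsKept p b i j)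
    (hF : x ∈ tri p i j ∧ y ∈ tri p i j ∧ v ∈ tri p i j) :
    EdgeRel (link (DeltaBk p b k) {v}) x y :=
  (edgeRel_link_iff fun _ hF _ => mem_DeltaBk_of_subset hb hF).2
    ⟨hxy, hx, hy, tri_face hb hi.1 hi.2 hj.1 hj.2 hk (triple_subset_iff.2 hF)⟩

/-- In the link of `v`, every vertex is joined to `v + p`. -/
lemma reflTransGen_link {p b k : ℕ} (hb : b + k < p) {u v : ℕ} (hv : v ∈ Finset.Icc 1 (3 * p))
    (huv : u ≠ v) (h : {u, v} ∈ DeltaBk p b k) :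
    Relation.ReflTransGen (EdgeRel (link (DeltaBk p b k) {v})) u (wrap p (v + p)) := by
  have hb' : b < p := by omega
  have hu := Finset.mem_Icc.1 (mem_Icc_of_mem_face hb h (x := u) (by simp))
  rw [Finset.mem_Icc] at hv
  have hE : ¬IsRemovedEdge p b u v ∧ ¬IsRemovedEdge p b v u := by
    rcases lt_or_gt_of_ne huv with hlt | hlt
    · exact ⟨((pair_mem_DeltaBk hb hlt).1 h).2.2, by unfold IsRemovedEdge; omega⟩
    · rw [Finset.pair_comm] at h
      exact ⟨by unfold IsRemovedEdge; omega, ((pair_mem_DeltaBk hb hlt).1 h).2.2⟩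
  have hS : EdgeRel (link (DeltaBk p b k) {v}) (wrap p (v + 2 * p)) (wrap p (v + p)) := by
    refine edgeRel_link_of_tri (i := v) (j := p) hb' ?_ ?_ ?_ hv (by omega)
      (by unfold IsKept; omega) ⟨?_, ?_, ?_⟩
    all_goals first | rw [mem_tri] | skip
    all_goals unfold wrap; split_ifs <;> omega
  have hmid : ∀ w, 1 ≤ w → w ≤ 3 * p → ∀ j, 1 ≤ j → j < p → w = wrap p (v + j + p) →
      IsKept p b v j → EdgeRel (link (DeltaBk p b k) {v}) w (wrap p (v + p)) := by
    intro w hw hw' j hj hjp hwj hk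
    refine edgeRel_link_of_tri (i := v) (j := j) hb' ?_ ?_ ?_ hv (by omega) hk ⟨?_, ?_, ?_⟩
    all_goals first | rw [mem_tri] | skip
    all_goals clear hS hE; unfold wrap at *; split_ifs at * <;> omega
  obtain ⟨o, ho, ho', hou⟩ : ∃ o, 1 ≤ o ∧ o < 3 * p ∧ u = wrap p (v + o) := by
    rcases lt_or_gt_of_ne huv with hlt | hlt
    · exact ⟨u + 3 * p - v, by omega, by omega, by unfold wrap; split_ifs <;> omega⟩
    · exact ⟨u - v, by omega, by omega, by unfold wrap; split_ifs <;> omega⟩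
  unfold IsRemovedEdge at hE
  obtain hd | hd | hd | hd | hd : o < p ∨ o = p ∨ (p < o ∧ o < 2 * p) ∨ o = 2 * p ∨ 2 * p < o := by
    omega
  · refine .head (b := wrap p (v + 2 * p)) ?_ (.single hS)
    refine edgeRel_link_of_tri (i := wrap p (v + 2 * p)) (j := o) hb' ?_ ?_ ?_ ?_ (by omega)
      ?_ ⟨?_, ?_, ?_⟩
    all_goals first | rw [mem_tri] | unfold IsKept | skip
    all_goals clear hS hmid; unfold wrap at *; split_ifs at * <;> omega
  · rw [hou, hd]
  · refine .single (hmid u hu.1 hu.2 (o - p) (by omega) (by omega) ?_ ?_)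
    · rw [hou]; congr 1; omega
    · unfold IsKept
      unfold wrap at hou
      split_ifs at hou <;> omega
  · rw [hou, hd]
    exact .single hS
  · refine .head (b := wrap p (v + (o - p))) ?_ (.single (hmid _ ?_ ?_ (o - 2 * p) (by omega)
      (by omega) ?_ ?_))
    · refine edgeRel_link_of_tri (i := wrap p (v + (o - p))) (j := 3 * p - o) hb' ?_ ?_ ?_ ?_
        (by omega) ?_ ⟨?_, ?_, ?_⟩
      all_goals first | rw [mem_tri] | unfold IsKept | skip
      all_goals clear hS hmid; unfold wrap at *; split_ifs at * <;> omega
    · unfold wrap; split_ifs <;> omega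
    · unfold wrap; split_ifs <;> omega
    · congr 1; omega
    · unfold IsKept
      unfold wrap at hou
      split_ifs at hou <;> omega

lemma isBuchsbaum_DeltaBk (K : Type) [Field K] {p b k : ℕ} (hb : b + k < p) :
    IsBuchsbaum K (DeltaBk p b k) := by
  have hb' : b < p := by omega
  refine ⟨isPure_DeltaBk hb', fun v hv => ?_⟩
  rw [singleton_mem_DeltaBk hb] at hv
  have hv' := Finset.mem_Icc.1 hv
  refine isCohenMacaulay_of_connected K (r := wrap p (v + p)) (s := wrap p (v + 2 * p)) ?_ ?_ ?_ ?_
  · intro F hF G hGF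
    simp only [link, Finset.mem_filter] at *
    exact ⟨mem_DeltaBk_of_subset hb' hF.1 hGF, hF.2.1.mono_left hGF,
      mem_DeltaBk_of_subset hb' hF.2.2 (Finset.union_subset_union_left hGF)⟩
  · intro F hF
    obtain ⟨-, hd, hF⟩ := Finset.mem_filter.1 hF
    have := card_le_three hb' hF
    rw [Finset.card_union_of_disjoint hd, Finset.card_singleton] at this
    omega
  · refine edgeRel_link_of_tri (i := v) (j := p) hb' ?_ ?_ ?_ hv' (by omega)
      (by unfold IsKept; omega) ⟨?_, ?_, ?_⟩
    all_goals first | rw [mem_tri] | skip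
    all_goals unfold wrap; split_ifs <;> omega
  · intro u hu
    obtain ⟨-, hd, hu⟩ := Finset.mem_filter.1 hu
    exact reflTransGen_link hb hv (by simpa [eq_comm] using hd) hu

/-! ### Face numbers of `Δ_k` -/

lemma card_facesOf_one {p b k : ℕ} (hb : b + k < p) :
    (facesOf (DeltaBk p b k) 1).card = 3 * p := by
  have : facesOf (DeltaBk p b k) 1 = (Finset.Icc 1 (3 * p)).image fun v => {v} := by
    ext F
    simp only [facesOf, Finset.mem_filter, Finset.mem_image, Finset.card_eq_one]
    constructor
    · rintro ⟨h, v, rfl⟩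
      exact ⟨v, (singleton_mem_DeltaBk hb).1 h, rfl⟩
    · rintro ⟨v, hv, rfl⟩
      exact ⟨(singleton_mem_DeltaBk hb).2 hv, v, rfl⟩
  rw [this, Finset.card_image_of_injective _ Finset.singleton_injective, Nat.card_Icc]
  omega

lemma pair_eq_pair_iff_of_lt {u v x y : ℕ} (h : u < v) (h' : x < y) :
    ({u, v} : Finset ℕ) = {x, y} ↔ u = x ∧ v = y := by
  refine ⟨fun he => ?_, by rintro ⟨rfl, rfl⟩; rfl⟩
  have h1 : u ∈ ({x, y} : Finset ℕ) := he ▸ by simp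
  have h2 : v ∈ ({x, y} : Finset ℕ) := he ▸ by simp
  simp only [Finset.mem_insert, Finset.mem_singleton] at h1 h2
  omega

lemma card_image_pair {a c b : ℕ} (hac : a ≤ c) :
    ((Finset.Icc 1 b).image fun j => ({a, c + j} : Finset ℕ)).card = b := by
  rw [Finset.card_image_of_injOn, Nat.card_Icc, Nat.add_sub_cancel]
  intro j hj j' hj' h
  simp only [Finset.coe_Icc, Set.mem_Icc] at hj hj'
  have := (pair_eq_pair_iff_of_lt (by omega) (by omega)).1 h
  omega

lemma disjoint_image_pair {a c a' c' b : ℕ} (h : a ≤ c) (h' : a' ≤ c')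
    (hd : a ≠ a' ∨ c + b ≤ c') :
    Disjoint ((Finset.Icc 1 b).image fun j => ({a, c + j} : Finset ℕ))
      ((Finset.Icc 1 b).image fun j => ({a', c' + j} : Finset ℕ)) := by
  simp only [Finset.disjoint_left, Finset.mem_image, Finset.mem_Icc]
  rintro _ ⟨j, hj, rfl⟩ ⟨j', hj', he⟩
  have := (pair_eq_pair_iff_of_lt (by omega) (by omega)).1 he
  omega

lemma card_facesOf_two {p b k : ℕ} (hb : b + k < p) :
    (facesOf (DeltaBk p b k) 2).card + 3 * b = (3 * p).choose 2 := by
  set R₁ := (Finset.Icc 1 b).image fun j => ({1 + p, 1 + p + j} : Finset ℕ) with hR₁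
  set R₂ := (Finset.Icc 1 b).image fun j => ({1, 1 + p + j} : Finset ℕ) with hR₂
  set R₃ := (Finset.Icc 1 b).image fun j => ({1, 1 + 2 * p + j} : Finset ℕ) with hR₃
  have hpair : ∀ u v, u < v → (({u, v} : Finset ℕ) ∈ R₁ ∪ (R₂ ∪ R₃) ↔ IsRemovedEdge p b u v) := by
    intro u v huv
    simp only [hR₁, hR₂, hR₃, Finset.mem_union, Finset.mem_image, Finset.mem_Icc]
    unfold IsRemovedEdge
    constructor
    · rintro (⟨j, hj, h⟩ | ⟨j, hj, h⟩ | ⟨j, hj, h⟩) <;>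
      · have := (pair_eq_pair_iff_of_lt (by omega) huv).1 h
        omega
    · rintro (⟨h1, h2, h3⟩ | ⟨h1, ⟨h2, h3⟩ | ⟨h2, h3⟩⟩)
      · exact Or.inl ⟨v - 1 - p, by omega,
          (pair_eq_pair_iff_of_lt (by omega) huv).2 (by omega)⟩
      · exact Or.inr (Or.inl ⟨v - 1 - p, by omega,
          (pair_eq_pair_iff_of_lt (by omega) huv).2 (by omega)⟩)
      · exact Or.inr (Or.inr ⟨v - 1 - 2 * p, by omega,
          (pair_eq_pair_iff_of_lt (by omega) huv).2 (by omega)⟩)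
  have hR : (R₁ ∪ (R₂ ∪ R₃)).card = 3 * b := by
    rw [Finset.card_union_of_disjoint, Finset.card_union_of_disjoint, hR₁, hR₂, hR₃,
      card_image_pair (by omega), card_image_pair (by omega), card_image_pair (by omega)]
    · omega
    · exact disjoint_image_pair (by omega) (by omega) (by omega)
    · rw [Finset.disjoint_union_right]
      exact ⟨disjoint_image_pair (by omega) (by omega) (by omega),
        disjoint_image_pair (by omega) (by omega) (by omega)⟩
  have hlt : ∀ F : Finset ℕ, F.card = 2 → ∃ u v, u < v ∧ F = {u, v} := by
    intro F hF
    obtain ⟨u, v, hne, rfl⟩ := Finset.card_eq_two.1 hF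
    rcases lt_or_gt_of_ne hne with h | h
    exacts [⟨u, v, h, rfl⟩, ⟨v, u, h, Finset.pair_comm _ _⟩]
  have hunion : facesOf (DeltaBk p b k) 2 ∪ (R₁ ∪ (R₂ ∪ R₃)) =
      Finset.powersetCard 2 (Finset.Icc 1 (3 * p)) := by
    ext F
    by_cases hF : F.card = 2
    · obtain ⟨u, v, huv, rfl⟩ := hlt F hF
      rw [Finset.mem_union, hpair u v huv, facesOf, Finset.mem_filter, pair_mem_DeltaBk hb huv,
        Finset.mem_powersetCard, pair_subset_iff, Finset.mem_Icc, Finset.mem_Icc]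
      simp only [hF, and_true]
      unfold IsRemovedEdge
      omega
    · have h1 : F ∉ R₁ ∪ (R₂ ∪ R₃) := by
        simp only [hR₁, hR₂, hR₃, Finset.mem_union, Finset.mem_image, Finset.mem_Icc]
        rintro (⟨j, hj, rfl⟩ | ⟨j, hj, rfl⟩ | ⟨j, hj, rfl⟩) <;>
          exact hF (Finset.card_pair (by omega))
      rw [Finset.mem_union, facesOf, Finset.mem_filter, Finset.mem_powersetCard]
      tauto
  have hdisj : Disjoint (facesOf (DeltaBk p b k) 2) (R₁ ∪ (R₂ ∪ R₃)) := by
    rw [Finset.disjoint_left]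
    intro F hF hFR
    obtain ⟨hF, hc⟩ := Finset.mem_filter.1 hF
    obtain ⟨u, v, huv, rfl⟩ := hlt F hc
    exact ((pair_mem_DeltaBk hb huv).1 hF).2.2 ((hpair u v huv).1 hFR)
  rw [← hR, ← Finset.card_union_of_disjoint hdisj, hunion, Finset.card_powersetCard, Nat.card_Icc,
    Nat.add_sub_cancel]

lemma card_isKept {p b : ℕ} (hb : b < p) :
    (((Finset.Icc 1 (3 * p)) ×ˢ (Finset.Icc 1 (p - 1))).filter
      fun q : ℕ × ℕ => IsKept p b q.1 q.2).card + 2 * b = 3 * p * (p - 1) := by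
  set A := (Finset.Icc 1 b).image fun j => (1, j) with hA
  set B := (Finset.Icc 1 b).image fun j => (1 + j + p, p - j) with hB
  have hAc : A.card = b := by
    rw [hA, Finset.card_image_of_injective _ (Prod.mk_right_injective 1), Nat.card_Icc,
      Nat.add_sub_cancel]
  have hBc : B.card = b := by
    rw [hB, Finset.card_image_of_injective, Nat.card_Icc, Nat.add_sub_cancel]
    intro x y h
    have := congrArg Prod.fst h
    simp only at this
    omega
  have hdisj : Disjoint A B := by
    simp only [hA, hB, Finset.disjoint_left, Finset.mem_image, Finset.mem_Icc]
    rintro _ ⟨j, hj, rfl⟩ ⟨j', hj', he⟩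
    rw [Prod.mk.injEq] at he
    omega
  have hnot : ((Finset.Icc 1 (3 * p)) ×ˢ (Finset.Icc 1 (p - 1))).filter
      (fun q : ℕ × ℕ => ¬IsKept p b q.1 q.2) = A ∪ B := by
    ext ⟨i, j⟩
    simp only [hA, hB, Finset.mem_filter, Finset.mem_product, Finset.mem_union, Finset.mem_image,
      Finset.mem_Icc, Prod.mk.injEq]
    unfold IsKept
    constructor
    · rintro ⟨⟨hi, hj⟩, h⟩
      by_cases h1 : i = 1 ∧ j ≤ b
      · exact Or.inl ⟨j, by omega⟩
      · exact Or.inr ⟨i - 1 - p, by omega⟩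
    · rintro (⟨x, hx⟩ | ⟨x, hx⟩) <;> omega
  have h := Finset.card_filter_add_card_filter_not
    (s := (Finset.Icc 1 (3 * p)) ×ˢ (Finset.Icc 1 (p - 1))) fun q : ℕ × ℕ => IsKept p b q.1 q.2
  rw [hnot, Finset.card_union_of_disjoint hdisj, hAc, hBc, Finset.card_product, Nat.card_Icc,
    Nat.card_Icc, Nat.add_sub_cancel, Nat.add_sub_cancel] at h
  omega

lemma facesOf_three {p b k : ℕ} (hb : b + k < p) :
    facesOf (DeltaBk p b k) 3 =
      ((((Finset.Icc 1 (3 * p)) ×ˢ (Finset.Icc 1 (p - 1))).filter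
        fun q : ℕ × ℕ => IsKept p b q.1 q.2).image fun q => tri p q.1 q.2) ∪
      ((Finset.Icc 1 p).image (fun i => tri p i p) ∪
        (Finset.Icc (b + 1) (b + k)).image (GB p)) := by
  have hb' : b < p := by omega
  ext F
  simp only [Finset.mem_union, Finset.mem_image, Finset.mem_filter, Finset.mem_product,
    Finset.mem_Icc, facesOf]
  constructor
  · rintro ⟨hF, hc⟩
    rw [DeltaBk, Finset.mem_union, mem_GammaB hb'] at hF
    rcases hF with ⟨i, j, h1, h2, h3, h4, h5, hF⟩ | hF
    · obtain rfl := Finset.eq_of_subset_of_card_le hF (by rw [hc, card_tri h1 h2 h3 h4])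
      obtain rfl | hjp := h4.eq_or_lt
      · obtain ⟨i', h1', h2', hS⟩ := mem_SigmaB.1 (tri_self_mem_SigmaB h1 h2)
        exact Or.inr (Or.inl ⟨i', ⟨h1', h2'⟩, (Finset.eq_of_subset_of_card_le hS
          (by rw [hc, card_tri h1' (by omega) h3 h4])).symm⟩)
      · exact Or.inl ⟨(i, j), ⟨⟨⟨h1, h2⟩, h3, by omega⟩, h5⟩, rfl⟩
    · simp only [Finset.mem_biUnion, Finset.mem_Icc, Finset.mem_powerset] at hF
      obtain ⟨j, hj, hF⟩ := hF
      exact Or.inr (Or.inr ⟨j, hj, (Finset.eq_of_subset_of_card_le hF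
        (by rw [hc, card_GB (by omega) (by omega)])).symm⟩)
  · rintro (⟨⟨i, j⟩, ⟨⟨⟨h1, h2⟩, h3, h4⟩, h5⟩, rfl⟩ | ⟨i, ⟨h1, h2⟩, rfl⟩ | ⟨j, ⟨h1, h2⟩, rfl⟩)
    · exact ⟨tri_face hb' h1 h2 h3 (by omega) h5 subset_rfl, card_tri h1 h2 h3 (by omega)⟩
    · exact ⟨tri_face hb' h1 (by omega) (by omega) le_rfl (by unfold IsKept; omega) subset_rfl,
        card_tri h1 (by omega) (by omega) le_rfl⟩
    · exact ⟨(mem_DeltaBk hb').2 (Or.inr ⟨j, h1, h2, subset_rfl⟩),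
        card_GB (by omega) (by omega)⟩

lemma card_facesOf_three {p b k : ℕ} (hb : b + k < p) :
    (facesOf (DeltaBk p b k) 3).card + 2 * b = 3 * p * (p - 1) + p + k := by
  have hb' : b < p := by omega
  rw [facesOf_three hb, Finset.card_union_of_disjoint, Finset.card_union_of_disjoint,
    Finset.card_image_of_injOn, Finset.card_image_of_injOn, Finset.card_image_of_injOn,
    Nat.card_Icc, Nat.card_Icc]
  · have := card_isKept hb'
    omega
  · intro j hj j' hj' h
    simp only [Finset.coe_Icc, Set.mem_Icc] at hj hj'
    have h1 : 1 + j + p ∈ GB p j' := h ▸ mem_GB.2 (by omega)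
    have h2 : 1 + j + 2 * p ∈ GB p j' := h ▸ mem_GB.2 (by omega)
    rw [mem_GB] at h1 h2
    omega
  · intro i hi i' hi' h
    simp only [Finset.coe_Icc, Set.mem_Icc] at hi hi'
    have h1 : i ∈ tri p i' p := by
      have : i ∈ tri p i p := mem_tri.2 (Or.inl rfl)
      rwa [show tri p i p = tri p i' p from h] at this
    rw [mem_tri] at h1
    unfold wrap at h1
    split_ifs at h1 <;> omega
  · rintro ⟨i, j⟩ hq ⟨i', j'⟩ hq' h
    simp only [Finset.coe_filter, Finset.mem_product, Finset.mem_Icc, Set.mem_ofPred_eq] at hq hq'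
    have := tri_subset_tri hq.1.2.1 hq'.1.1.1 hq'.1.1.2 hq'.1.2.1 (by omega)
      (by omega) (Eq.subset h)
    rw [Prod.mk.injEq]
    exact this
  · simp only [Finset.disjoint_left, Finset.mem_image, Finset.mem_Icc]
    rintro _ ⟨i, hi, rfl⟩ ⟨j, hj, h⟩
    have h1 : 1 + p ∈ tri p i p := h ▸ mem_GB.2 (by omega)
    have h2 : 1 + j + p ∈ tri p i p := h ▸ mem_GB.2 (by omega)
    rw [mem_tri] at h1 h2
    unfold wrap at h1 h2
    split_ifs at h1 h2 <;> omega
  · simp only [Finset.disjoint_left, Finset.mem_image, Finset.mem_filter, Finset.mem_product,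
      Finset.mem_union, Finset.mem_Icc]
    rintro _ ⟨⟨i, j⟩, ⟨⟨⟨h1, h2⟩, h3, h4⟩, -⟩, rfl⟩ (⟨i', hi', h⟩ | ⟨j', hj', h⟩)
    · have m1 : i' ∈ tri p i j := h ▸ mem_tri.2 (Or.inl rfl)
      have m2 : wrap p (i' + p) ∈ tri p i j := h ▸ mem_tri.2 (Or.inr (Or.inl rfl))
      have m3 : wrap p (i' + p + p) ∈ tri p i j := h ▸ mem_tri.2 (Or.inr (Or.inr rfl))
      simp only at h1 h2 h3 h4
      have e1 := eq_of_mem_tri h1 h2 h3 (by omega) m1 m2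
      rw [wrap_of_le (by omega : i' + p ≤ 3 * p)] at m2
      have e2 := eq_of_mem_tri h1 h2 h3 (by omega) m2 m3
      omega
    · have m1 : 1 + p ∈ tri p i j := h ▸ mem_GB.2 (by omega)
      have m2 : 1 + j' + p ∈ tri p i j := h ▸ mem_GB.2 (by omega)
      have m3 : wrap p (1 + j' + p + p) ∈ tri p i j := by
        rw [wrap_of_le (by omega)]
        exact h ▸ mem_GB.2 (by omega)
      have e1 := eq_of_mem_tri h1 h2 h3 (by omega) m2 m3
      simp only [mem_tri] at m1
      simp only at h1 h2 h3 h4 e1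
      unfold wrap at m1
      split_ifs at m1 <;> omega

lemma hVector3_DeltaBk {p b k : ℕ} (hb : b + k < p) :
    hVector3 (DeltaBk p b k) 1 (((3 * p : ℕ) : ℤ) - 3)
      (3 * ((((3 * p - 2).choose 2 / 3 : ℕ) : ℤ) - (b : ℤ)))
      (-((((3 * p - 2).choose 2 / 3 : ℕ) : ℤ) - (b : ℤ)) + (k : ℤ)) := by
  obtain ⟨q, rfl⟩ : ∃ q, p = q + 1 := ⟨p - 1, by omega⟩
  have f1 := card_facesOf_one hb
  have f2 := card_facesOf_two hb
  have f3 := card_facesOf_three hb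
  obtain ⟨M, hM⟩ : Even ((3 * q + 1) * q) := by
    rcases Nat.even_or_odd q with h | h
    · exact h.mul_left _
    · exact Even.mul_right (by grind) _
  have hchoose : (3 * (q + 1) - 2).choose 2 / 3 = M := by
    have : (3 * (q + 1) - 2).choose 2 = 3 * M := by
      rw [Nat.choose_two_right, show 3 * (q + 1) - 2 = 3 * q + 1 by omega, Nat.add_sub_cancel,
        Nat.div_eq_of_eq_mul_right two_pos]
      linarith
    omega
  have hchoose' : (3 * (q + 1)).choose 2 = 3 * M + 6 * q + 3 := by
    rw [Nat.choose_two_right, show 3 * (q + 1) - 1 = 3 * q + 2 by omega,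
      Nat.div_eq_of_eq_mul_right two_pos]
    linarith
  have hprod : 3 * (q + 1) * (q + 1 - 1) = 2 * M + 2 * q := by
    rw [Nat.add_sub_cancel]
    linarith
  rw [hchoose]
  rw [hchoose'] at f2
  rw [hprod] at f3
  simp only [hVector3, hVec, fVec, Finset.sum_range_succ, Finset.sum_range_zero]
  have c1 : Nat.choose 3 2 = 3 := rfl
  refine ⟨?_, ?_, ?_, ?_⟩ <;> norm_num [c1] <;> omega

/-- **Lemma 3.6.** For `n = 3p`, `b + c ≤ p-2`, and `0 ≤ k ≤ c`, the complex `Δ_k`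
is connected, Buchsbaum, and `h(Δ_k) = (1, n-3, 3(M-b), -(M-b)+k)`. -/
theorem stmt16 (K : Type) [Field K] (p b c : ℕ) (hp : 2 ≤ p) (hbc : b + c ≤ p - 2) :
    ∀ k ≤ c, IsConnectedComplex (DeltaBk p b k) ∧ IsBuchsbaum K (DeltaBk p b k) ∧
      hVector3 (DeltaBk p b k) 1 (((3 * p : ℕ) : ℤ) - 3)
        (3 * ((((3 * p - 2).choose 2 / 3 : ℕ) : ℤ) - (b : ℤ))) (-((((3 * p - 2).choose 2 / 3 : ℕ) : ℤ) - (b : ℤ)) + (k : ℤ)) := by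
  intro k hk
  have hb : b + k + 1 < p := by omega
  exact ⟨isConnectedComplex_DeltaBk hb, isBuchsbaum_DeltaBk K (by omega), hVector3_DeltaBk (by omega)⟩
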